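/- Let 𝒜 be of nonstandard p(·)-growth with constants a₋, b⁺ and assume p⁻ > n. Let f : ℝ → ℝ be continuous and nonnegative, and let u be a supersolution of div 𝒜(x,u,∇u) = f(u) in ℝⁿ with |u(x)| ≤ M for all x. Then there is a constant C depending only on n, p⁺, a₋, b⁺ and M such that ∫_{B_R} f(u(x)) dx ≤ C R^{n−p⁻} for every R > 1; consequently ∫_{ℝⁿ} f(u(x)) dx = 0 and f(u(x)) = 0 for every x ∈ ℝⁿ. -/

import Mathlib

open MeasureTheory Metric Real
open scoped ContDiff

noncomputable section

abbrev Euc (n : ℕ) := EuclideanSpace ℝ (Fin n)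

/-- Measure of the unit ball in `ℝⁿ`. -/
def omegaEuc (n : ℕ) : ℝ := (volume (Metric.ball (0 : Euc n) 1)).toReal

/-- A measurable variable exponent `p` with `p⁻ = pm` and `p⁺ = pP`,
`1 < p⁻` and `p⁺ < ∞` (encoded by the a.e. bounds). -/
structure IsVarExp {n : ℕ} (p : Euc n → ℝ) (pm pP : ℝ) : Prop where
  meas : Measurable p
  one_lt : 1 < pm
  inf_eq : essInf p (volume : Measure (Euc n)) = pm
  sup_eq : essSup p (volume : Measure (Euc n)) = pP
  ae_lb : ∀ᵐ x ∂(volume : Measure (Euc n)), pm ≤ p x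
  ae_ub : ∀ᵐ x ∂(volume : Measure (Euc n)), p x ≤ pP

/-- `𝒜` is of nonstandard `p(·)`-growth with constants `am = a₋`, `bP = b⁺`. -/
structure IsNSGrowth {n : ℕ} (p : Euc n → ℝ) (𝒜 : Euc n → ℝ → Euc n → Euc n)
    (am bP : ℝ) : Prop where
  am_pos : 0 < am
  meas : ∀ (t : ℝ) (ξ : Euc n), Measurable (fun x => 𝒜 x t ξ)
  cont : ∀ x : Euc n, Continuous (fun tξ : ℝ × Euc n => 𝒜 x tξ.1 tξ.2)
  growth : ∃ a b : Euc n → ℝ, Measurable a ∧ Measurable b ∧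
      (∀ x, am ≤ a x ∧ a x ≤ b x ∧ b x ≤ bP) ∧
      (∀ x t ξ, a x * ‖ξ‖ ^ p x ≤ (inner ℝ (𝒜 x t ξ) ξ : ℝ)) ∧
      (∀ x t ξ, ‖𝒜 x t ξ‖ ≤ b x * ‖ξ‖ ^ (p x - 1))

/-- `u` is `𝒜`-harmonic in `ℝⁿ` (C¹ functions replace `W^{1,p(·)}_loc`). -/
def IsAHarmonic {n : ℕ} (p : Euc n → ℝ) (𝒜 : Euc n → ℝ → Euc n → Euc n)
    (u : Euc n → ℝ) : Prop :=
  ContDiff ℝ 1 u ∧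
  LocallyIntegrable (fun x => ‖gradient u x‖ ^ p x) (volume : Measure (Euc n)) ∧
  ∀ φ : Euc n → ℝ, ContDiff ℝ ∞ φ → HasCompactSupport φ →
    ∫ x, (inner ℝ (𝒜 x (u x) (gradient u x)) (gradient φ x) : ℝ) = 0

/-- `u` is an `𝒜`-subsolution in `ℝⁿ`. -/
def IsASubsolution {n : ℕ} (p : Euc n → ℝ) (𝒜 : Euc n → ℝ → Euc n → Euc n)
    (u : Euc n → ℝ) : Prop :=
  ContDiff ℝ 1 u ∧
  LocallyIntegrable (fun x => ‖gradient u x‖ ^ p x) (volume : Measure (Euc n)) ∧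
  ∀ φ : Euc n → ℝ, ContDiff ℝ ∞ φ → HasCompactSupport φ → (∀ x, 0 ≤ φ x) →
    ∫ x, (inner ℝ (𝒜 x (u x) (gradient u x)) (gradient φ x) : ℝ) ≤ 0

/-- `ℬ` is an admissible right-hand side. -/
structure IsAdmissibleRHS {n : ℕ} (p : Euc n → ℝ) (ℬ : Euc n → ℝ → Euc n → ℝ) : Prop where
  meas : ∀ (t : ℝ) (ξ : Euc n), Measurable (fun x => ℬ x t ξ)
  cont : ∀ x : Euc n, Continuous (fun tξ : ℝ × Euc n => ℬ x tξ.1 tξ.2)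
  bound : ∃ c : Euc n → ℝ, Measurable c ∧ (∃ cP : ℝ, ∀ x, c x ≤ cP) ∧
      ∀ x t ξ, |ℬ x t ξ| ≤ c x * (1 + ‖ξ‖ ^ (p x - 1))

/-- `u` is `(𝒜,ℬ)`-harmonic in `ℝⁿ`. -/
def IsABHarmonic {n : ℕ} (p : Euc n → ℝ) (𝒜 : Euc n → ℝ → Euc n → Euc n)
    (ℬ : Euc n → ℝ → Euc n → ℝ) (u : Euc n → ℝ) : Prop :=
  ContDiff ℝ 1 u ∧
  LocallyIntegrable (fun x => ‖gradient u x‖ ^ p x) (volume : Measure (Euc n)) ∧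
  ∀ φ : Euc n → ℝ, ContDiff ℝ ∞ φ → HasCompactSupport φ →
    ∫ x, (inner ℝ (𝒜 x (u x) (gradient u x)) (gradient φ x) : ℝ)
      = ∫ x, ℬ x (u x) (gradient u x) * φ x

/-- `u` is a supersolution of `div 𝒜(x,u,∇u) = f(u)` in `ℝⁿ`. -/
def IsFSupersolution {n : ℕ} (p : Euc n → ℝ) (𝒜 : Euc n → ℝ → Euc n → Euc n)
    (f : ℝ → ℝ) (u : Euc n → ℝ) : Prop :=
  ContDiff ℝ 1 u ∧
  LocallyIntegrable (fun x => ‖gradient u x‖ ^ p x) (volume : Measure (Euc n)) ∧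
  ∀ φ : Euc n → ℝ, ContDiff ℝ ∞ φ → HasCompactSupport φ → (∀ x, 0 ≤ φ x) →
    ∫ x, f (u x) * φ x ≤ - ∫ x, (inner ℝ (𝒜 x (u x) (gradient u x)) (gradient φ x) : ℝ)


section Mollification

open Filter Topology ContinuousLinearMap
open scoped Convolution

/-- A sequence of bump functions centred at the origin whose supports shrink to a point. -/
def shrinkingBump (E : Type*) [NormedAddCommGroup E] (k : ℕ) : ContDiffBump (0 : E) where
  rIn := 1 / ((k : ℝ) + 1) / 2
  rOut := 1 / ((k : ℝ) + 1)
  rIn_pos := by positivity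
  rIn_lt_rOut := half_lt_self (by positivity)

lemma shrinkingBump_rOut_le_one (E : Type*) [NormedAddCommGroup E] (k : ℕ) :
    (shrinkingBump E k).rOut ≤ 1 := by
  change 1 / ((k : ℝ) + 1) ≤ 1
  rw [div_le_one (by positivity)]
  linarith [(k.cast_nonneg : (0 : ℝ) ≤ k)]

lemma tendsto_shrinkingBump_rOut (E : Type*) [NormedAddCommGroup E] :
    Tendsto (fun k => (shrinkingBump E k).rOut) atTop (𝓝 0) :=
  tendsto_one_div_add_atTop_nhds_zero_nat

variable {E : Type*} [NormedAddCommGroup E] [InnerProductSpace ℝ E] [FiniteDimensional ℝ E]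
  [MeasurableSpace E] [BorelSpace E] {μ : Measure E} [μ.IsAddHaarMeasure]

lemma locallyIntegrable_shrinkingBump (k : ℕ) :
    LocallyIntegrable ((shrinkingBump E k).normed μ) μ :=
  (shrinkingBump E k).continuous_normed.locallyIntegrable

lemma hasCompactSupport_mollify {F : Type*} [NormedAddCommGroup F] [NormedSpace ℝ F]
    {w : E → F} (hw : HasCompactSupport w) (k : ℕ) :
    HasCompactSupport ((shrinkingBump E k).normed μ ⋆[lsmul ℝ ℝ, μ] w) :=
  (shrinkingBump E k).hasCompactSupport_normed.convolution _ hw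

lemma norm_mollify_le {F : Type*} [NormedAddCommGroup F] [NormedSpace ℝ F] [CompleteSpace F]
    {w : E → F} (hw : Continuous w) (hwc : HasCompactSupport w) :
    ∃ C : ℝ, ∃ K : Set E, IsCompact K ∧ ∀ k x,
      ‖((shrinkingBump E k).normed μ ⋆[lsmul ℝ ℝ, μ] w) x‖ ≤ K.indicator (fun _ => C) x := by
  obtain ⟨C, hC⟩ := hwc.exists_bound_of_continuous hw
  have hK : IsCompact (tsupport w) := hwc
  refine ⟨C + C + C, cthickening 1 (tsupport w), hK.cthickening, fun k x => ?_⟩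
  by_cases hx : x ∈ cthickening 1 (tsupport w)
  · rw [Set.indicator_of_mem hx]
    have h := (shrinkingBump E k).dist_normed_convolution_le (μ := μ) (x₀ := x) (ε := C + C)
      hw.aestronglyMeasurable (fun y _ => (dist_le_norm_add_norm _ _).trans
        (add_le_add (hC y) (hC x)))
    rw [dist_eq_norm] at h
    have h2 := norm_le_norm_add_norm_sub' (((shrinkingBump E k).normed μ ⋆[lsmul ℝ ℝ, μ] w) x) (w x)
    linarith [hC x]
  · rw [Set.indicator_of_notMem hx, norm_le_zero_iff]
    by_contra hne
    have hmem := support_convolution_subset (lsmul ℝ ℝ) (μ := μ)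
      (f := (shrinkingBump E k).normed μ) (g := w) (Function.mem_support.2 hne)
    rw [ContDiffBump.support_normed_eq] at hmem
    obtain ⟨a, ha, b, hb, rfl⟩ := hmem
    refine hx (mem_cthickening_of_dist_le _ b 1 _ (subset_tsupport w hb) ?_)
    simp only [dist_eq_norm, add_sub_cancel_right]
    exact (mem_ball_zero_iff.1 ha).le.trans (shrinkingBump_rOut_le_one E k)

lemma tendsto_integral_mollify {F H : Type*} [NormedAddCommGroup F] [NormedSpace ℝ F]
    [CompleteSpace F] [NormedAddCommGroup H] [NormedSpace ℝ H] (B : H →L[ℝ] F →L[ℝ] ℝ)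
    {h : E → H} (hh : LocallyIntegrable h μ)
    {w : E → F} (hw : Continuous w) (hwc : HasCompactSupport w) :
    Tendsto (fun k => ∫ x, B (h x) (((shrinkingBump E k).normed μ ⋆[lsmul ℝ ℝ, μ] w) x) ∂μ)
      atTop (𝓝 (∫ x, B (h x) (w x) ∂μ)) := by
  obtain ⟨C, K, hK, hbound⟩ := norm_mollify_le (μ := μ) hw hwc
  refine tendsto_integral_of_dominated_convergence
    (K.indicator (fun x => ‖B‖ * ‖h x‖ * C)) (fun k => ?_) ?_ (fun k => ?_) ?_
  · refine B.aestronglyMeasurable_comp₂ hh.aestronglyMeasurable ?_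
    exact (hwc.continuous_convolution_right _ (locallyIntegrable_shrinkingBump k)
      hw).aestronglyMeasurable
  · rw [integrable_indicator_iff hK.measurableSet]
    exact ((hh.integrableOn_isCompact hK).norm.const_mul _).mul_const _
  · filter_upwards with x
    refine (B.le_opNorm₂ _ _).trans ((mul_le_mul_of_nonneg_left (hbound k x)
      (by positivity)).trans_eq ?_)
    by_cases hx : x ∈ K <;> simp [hx]
  · filter_upwards with x
    exact ((B (h x)).continuous.tendsto _).comp
      (ContDiffBump.convolution_tendsto_right_of_continuous
        (tendsto_shrinkingBump_rOut E) hw x)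

lemma fderiv_mollify {φ : E → ℝ} (hφ : ContDiff ℝ 1 φ) (hφc : HasCompactSupport φ) (k : ℕ) :
    fderiv ℝ ((shrinkingBump E k).normed μ ⋆[lsmul ℝ ℝ, μ] φ) =
      (shrinkingBump E k).normed μ ⋆[lsmul ℝ ℝ, μ] fderiv ℝ φ := by
  ext1 x
  rw [(hφc.hasFDerivAt_convolution_right (lsmul ℝ ℝ) (locallyIntegrable_shrinkingBump (μ := μ) k)
    hφ x).fderiv]
  rfl

/-- A weak differential inequality tested against smooth functions
may be tested against `C¹` functions. -/
lemma weak_inequality_of_contDiff_one {g : E → ℝ} (hg : LocallyIntegrable g μ) {V : E → E}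
    (hV : LocallyIntegrable V μ)
    (H : ∀ φ : E → ℝ, ContDiff ℝ ∞ φ → HasCompactSupport φ → (∀ x, 0 ≤ φ x) →
      ∫ x, g x * φ x ∂μ ≤ -∫ x, fderiv ℝ φ x (V x) ∂μ)
    {φ : E → ℝ} (hφ : ContDiff ℝ 1 φ) (hφc : HasCompactSupport φ) (hφ0 : ∀ x, 0 ≤ φ x) :
    ∫ x, g x * φ x ∂μ ≤ -∫ x, fderiv ℝ φ x (V x) ∂μ := by
  have h1 := tendsto_integral_mollify (ContinuousLinearMap.mul ℝ ℝ) hg hφ.continuous hφc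
  have h2 := tendsto_integral_mollify (ContinuousLinearMap.apply ℝ ℝ) hV
    (hφ.continuous_fderiv one_ne_zero) (hφc.fderiv ℝ)
  refine le_of_tendsto_of_tendsto' h1 h2.neg fun k => ?_
  have hk := H ((shrinkingBump E k).normed μ ⋆[lsmul ℝ ℝ, μ] φ)
    ((shrinkingBump E k).hasCompactSupport_normed.contDiff_convolution_left _
      (shrinkingBump E k).contDiff_normed hφ.continuous.locallyIntegrable)
    (hasCompactSupport_mollify hφc k)
    (fun x => integral_nonneg fun t => mul_nonneg ((shrinkingBump E k).nonneg_normed t) (hφ0 _))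
  rw [fderiv_mollify hφ hφc] at hk
  exact hk

end Mollification

section Caccioppoli

open Filter Topology

/-- The absorption inequality behind the Caccioppoli estimate. -/
lemma absorb_gradient_term {a K η s e p : ℝ} {N : ℕ} (ha : 0 < a) (hK : 0 ≤ K) (hη0 : 0 ≤ η)
    (hη1 : η ≤ 1) (hs : 0 ≤ s) (he : 0 ≤ e) (hp : 1 < p) (hpN : p ≤ N + 1) :
    K * (η ^ N * s ^ (p - 1) * e) ≤ a * (η ^ (N + 1) * s ^ p) + a * (K * e / a) ^ p := by
  have hsplit : ∀ t : ℝ, 0 ≤ t → t ^ p = t ^ (p - 1) * t := fun t ht => by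
    rw [← Real.rpow_add_one' ht (by linarith), sub_add_cancel]
  have hKe : 0 ≤ K * e / a := by positivity
  rcases le_total (K * e) (a * (η * s)) with h | h
  · have h1 : η ^ N * s ^ (p - 1) * (K * e) ≤ η ^ N * s ^ (p - 1) * (a * (η * s)) :=
      mul_le_mul_of_nonneg_left h (by positivity)
    have h2 : 0 ≤ a * (K * e / a) ^ p := by positivity
    rw [hsplit s hs, pow_succ]
    nlinarith
  · have h1 : η * s ≤ K * e / a := by rw [le_div_iff₀ ha]; linarith
    have h2 : η ^ N ≤ η ^ (p - 1) := by
      rw [← Real.rpow_natCast]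
      exact Real.rpow_le_rpow_of_exponent_ge' hη0 hη1 (by linarith) (by linarith)
    have h3 : η ^ N * s ^ (p - 1) ≤ (K * e / a) ^ (p - 1) :=
      calc η ^ N * s ^ (p - 1) ≤ η ^ (p - 1) * s ^ (p - 1) := by gcongr
        _ = (η * s) ^ (p - 1) := (Real.mul_rpow hη0 hs).symm
        _ ≤ _ := Real.rpow_le_rpow (by positivity) h1 (by linarith)
    have h4 : 0 ≤ a * (η ^ (N + 1) * s ^ p) := by positivity
    calc K * (η ^ N * s ^ (p - 1) * e) = η ^ N * s ^ (p - 1) * (K * e) := by ring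
      _ ≤ (K * e / a) ^ (p - 1) * (K * e) := by gcongr
      _ = a * (K * e / a) ^ p := by rw [hsplit _ hKe]; field_simp
      _ ≤ _ := by linarith

lemma rpow_div_le_max_rpow_mul {c t R p pm pP : ℝ} (ht : 0 ≤ t) (htc : t ≤ c / R)
    (hR : 1 < R) (hpm : 0 < pm) (h1 : pm ≤ p) (h2 : p ≤ pP) :
    t ^ p ≤ (max 1 c) ^ pP * R ^ (-pm) := by
  have hR0 : 0 < R := by linarith
  have hmax : (1 : ℝ) ≤ max 1 c := le_max_left _ _
  calc t ^ p ≤ (max 1 c / R) ^ p := by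
        refine Real.rpow_le_rpow ht (htc.trans ?_) (by linarith)
        gcongr
        exact le_max_right _ _
    _ = (max 1 c) ^ p * R ^ (-p) := by
        rw [Real.div_rpow (by linarith) hR0.le, Real.rpow_neg hR0.le, div_eq_mul_inv]
    _ ≤ (max 1 c) ^ pP * R ^ (-pm) := by
        gcongr
        exact hR.le

lemma exists_scaled_cutoff (E : Type*) [NormedAddCommGroup E] [InnerProductSpace ℝ E]
    [FiniteDimensional ℝ E] :
    ∃ c : ℝ, 0 ≤ c ∧ ∀ R : ℝ, 0 < R → ∃ χ : E → ℝ, ContDiff ℝ ∞ χ ∧ (∀ x, 0 ≤ χ x) ∧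
      (∀ x, χ x ≤ 1) ∧ (∀ x ∈ closedBall (0 : E) R, χ x = 1) ∧
      tsupport χ ⊆ closedBall (0 : E) (2 * R) ∧ ∀ x, ‖fderiv ℝ χ x‖ ≤ c / R := by
  let χ₁ : ContDiffBump (0 : E) := ⟨1, 2, one_pos, one_lt_two⟩
  have hχ₁ : ContDiff ℝ ∞ χ₁ := χ₁.contDiff
  obtain ⟨c, hc⟩ := (χ₁.hasCompactSupport.fderiv ℝ).exists_bound_of_continuous
    (hχ₁.continuous_fderiv (by simp))
  refine ⟨c, (norm_nonneg _).trans (hc 0), fun R hR => ⟨fun x => χ₁ (R⁻¹ • x),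
    hχ₁.comp (contDiff_const_smul _), fun x => χ₁.nonneg, fun x => χ₁.le_one, fun x hx => ?_,
    ?_, fun x => ?_⟩⟩
  · refine χ₁.one_of_mem_closedBall ?_
    rw [mem_closedBall_zero_iff] at hx ⊢
    rw [norm_smul, Real.norm_of_nonneg (by positivity), inv_mul_le_iff₀ hR]
    simpa [χ₁] using hx
  · refine closure_minimal (fun x hx => ?_) isClosed_closedBall
    have h : R⁻¹ • x ∈ Function.support χ₁ := hx
    rw [χ₁.support_eq, mem_ball_zero_iff, norm_smul, Real.norm_of_nonneg (by positivity),
      inv_mul_lt_iff₀ hR] at h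
    rw [mem_closedBall_zero_iff]
    linarith [h.le, mul_comm R (2 : ℝ), show χ₁.rOut = 2 from rfl]
  · rw [fderiv_comp_smul, norm_smul, Real.norm_of_nonneg (by positivity), div_eq_inv_mul]
    exact mul_le_mul_of_nonneg_left (hc _) (by positivity)

variable {n : ℕ} {p : Euc n → ℝ} {pm pP : ℝ} {𝒜 : Euc n → ℝ → Euc n → Euc n} {am bP : ℝ}
  {f : ℝ → ℝ} {u : Euc n → ℝ}

lemma inner_gradient_eq_fderiv (v : Euc n) (φ : Euc n → ℝ) (x : Euc n) :
    (inner ℝ v (gradient φ x) : ℝ) = fderiv ℝ φ x v := by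
  rw [real_inner_comm, gradient, InnerProductSpace.toDual_symm_apply]

lemma continuous_gradient_of_contDiff (hu : ContDiff ℝ 1 u) : Continuous (gradient u) :=
  (InnerProductSpace.toDual ℝ (Euc n)).symm.continuous.comp (hu.continuous_fderiv one_ne_zero)

lemma IsNSGrowth.measurable_flux (h𝒜 : IsNSGrowth p 𝒜 am bP) (hu : ContDiff ℝ 1 u) :
    Measurable (fun x => 𝒜 x (u x) (gradient u x)) := by
  have h : Measurable (Function.uncurry (fun (q : ℝ × Euc n) (x : Euc n) => 𝒜 x q.1 q.2)) :=
    measurable_uncurry_of_continuous_of_measurable (fun x => h𝒜.cont x)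
      (fun q => h𝒜.meas q.1 q.2)
  exact h.comp ((hu.continuous.measurable.prodMk
    (continuous_gradient_of_contDiff hu).measurable).prodMk measurable_id)

lemma IsNSGrowth.bP_pos (h𝒜 : IsNSGrowth p 𝒜 am bP) : 0 < bP := by
  obtain ⟨a, b, -, -, hab, -, -⟩ := h𝒜.growth
  obtain ⟨h1, h2, h3⟩ := hab 0
  linarith [h𝒜.am_pos]

lemma IsNSGrowth.norm_le (h𝒜 : IsNSGrowth p 𝒜 am bP) (x : Euc n) (t : ℝ) (ξ : Euc n) :
    ‖𝒜 x t ξ‖ ≤ bP * ‖ξ‖ ^ (p x - 1) := by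
  obtain ⟨a, b, -, -, hab, -, hb⟩ := h𝒜.growth
  exact (hb x t ξ).trans (mul_le_mul_of_nonneg_right (hab x).2.2 (by positivity))

lemma IsNSGrowth.le_inner (h𝒜 : IsNSGrowth p 𝒜 am bP) (x : Euc n) (t : ℝ) (ξ : Euc n) :
    am * ‖ξ‖ ^ p x ≤ (inner ℝ (𝒜 x t ξ) ξ : ℝ) := by
  obtain ⟨a, b, -, -, hab, ha, -⟩ := h𝒜.growth
  exact (mul_le_mul_of_nonneg_right (hab x).1 (by positivity)).trans (ha x t ξ)

lemma IsNSGrowth.locallyIntegrable_flux (hp : IsVarExp p pm pP) (h𝒜 : IsNSGrowth p 𝒜 am bP)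
    (hu : ContDiff ℝ 1 u)
    (hint : LocallyIntegrable (fun x => ‖gradient u x‖ ^ p x) (volume : Measure (Euc n))) :
    LocallyIntegrable (fun x => 𝒜 x (u x) (gradient u x)) := by
  have hdom : LocallyIntegrable (fun x => bP * (1 + ‖gradient u x‖ ^ p x))
      (volume : Measure (Euc n)) :=
    ((locallyIntegrable_const (1 : ℝ)).add hint).smul bP
  refine hdom.mono (h𝒜.measurable_flux hu).aestronglyMeasurable ?_
  filter_upwards [hp.ae_lb] with x hx
  have hpx : 1 < p x := hp.one_lt.trans_le hx
  refine (h𝒜.norm_le x _ _).trans ((mul_le_mul_of_nonneg_left ?_ h𝒜.bP_pos.le).trans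
    (le_abs_self _))
  have h0 := norm_nonneg (gradient u x)
  rcases le_total ‖gradient u x‖ 1 with h | h
  · have h1 := Real.rpow_le_one h0 h (show 0 ≤ p x - 1 by linarith)
    have h2 := Real.rpow_nonneg h0 (p x)
    linarith
  · have h1 := Real.rpow_le_rpow_of_exponent_le h (show p x - 1 ≤ p x by linarith)
    linarith

/-- Pointwise estimate for the flux of `u` tested against `χ ^ (N + 1) * (u + M + 1)`. -/
lemma IsNSGrowth.neg_fderiv_test_le (h𝒜 : IsNSGrowth p 𝒜 am bP) (hu : ContDiff ℝ 1 u)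
    {M : ℝ} (hbdd : ∀ x, |u x| ≤ M) {χ : Euc n → ℝ} (hχ : ContDiff ℝ ∞ χ)
    (hχ0 : ∀ x, 0 ≤ χ x) (hχ1 : ∀ x, χ x ≤ 1) {N : ℕ} {x : Euc n}
    (hp1 : 1 < p x) (hpN : p x ≤ N + 1) :
    -fderiv ℝ (fun y => χ y ^ (N + 1) * (u y + M + 1)) x (𝒜 x (u x) (gradient u x)) ≤
      am * ((2 * M + 1) * (N + 1) * bP * ‖fderiv ℝ χ x‖ / am) ^ p x := by
  set V := 𝒜 x (u x) (gradient u x)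
  have hux := abs_le.1 (hbdd x)
  have hbP := h𝒜.bP_pos
  have hχd : HasFDerivAt χ (fderiv ℝ χ x) x := (hχ.differentiable (by simp) x).hasFDerivAt
  have hud : HasFDerivAt u (fderiv ℝ u x) x := (hu.differentiable (by simp) x).hasFDerivAt
  have hd : HasFDerivAt (fun y => χ y ^ (N + 1) * (u y + M + 1)) _ x :=
    (hχd.pow (N + 1)).mul ((hud.add_const M).add_const 1)
  have hfd : fderiv ℝ (fun y => χ y ^ (N + 1) * (u y + M + 1)) x V =
      χ x ^ (N + 1) * fderiv ℝ u x V
        + (u x + M + 1) * ((N + 1) * χ x ^ N * fderiv ℝ χ x V) := by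
    rw [hd.fderiv]
    simp
  have hgrad : am * ‖gradient u x‖ ^ p x ≤ fderiv ℝ u x V := by
    rw [← inner_gradient_eq_fderiv]
    exact h𝒜.le_inner x _ _
  have hflux : -fderiv ℝ χ x V ≤ ‖fderiv ℝ χ x‖ * (bP * ‖gradient u x‖ ^ (p x - 1)) :=
    (neg_le_abs _).trans (((fderiv ℝ χ x).le_opNorm V).trans
      (mul_le_mul_of_nonneg_left (h𝒜.norm_le x _ _) (norm_nonneg _)))
  have h0 : 0 ≤ χ x := hχ0 x
  have hM : 0 ≤ M := by linarith
  have h1 : χ x ^ (N + 1) * (am * ‖gradient u x‖ ^ p x) ≤ χ x ^ (N + 1) * fderiv ℝ u x V :=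
    mul_le_mul_of_nonneg_left hgrad (by positivity)
  have h2 : (u x + M + 1) * ((N + 1) * χ x ^ N * -fderiv ℝ χ x V) ≤
      (2 * M + 1) * ((N + 1) * χ x ^ N *
        (‖fderiv ℝ χ x‖ * (bP * ‖gradient u x‖ ^ (p x - 1)))) := by
    refine (mul_le_mul_of_nonneg_left (mul_le_mul_of_nonneg_left hflux (by positivity))
      (by linarith)).trans (mul_le_mul_of_nonneg_right (by linarith) (by positivity))
  have h3 := absorb_gradient_term (K := (2 * M + 1) * (N + 1) * bP) h𝒜.am_pos (by positivity) h0
    (hχ1 x) (norm_nonneg (gradient u x)) (norm_nonneg (fderiv ℝ χ x)) hp1 hpN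
  rw [hfd]
  nlinarith

/-- The energy estimate: `∫_{B_R} f(u) ≤ C R ^ (n - p⁻)` for `R > 1`. -/
lemma exists_setIntegral_ball_le (hp : IsVarExp p pm pP) (h𝒜 : IsNSGrowth p 𝒜 am bP)
    (hfc : Continuous f) (hf0 : ∀ t, 0 ≤ f t) (hu : IsFSupersolution p 𝒜 f u)
    {M : ℝ} (hbdd : ∀ x, |u x| ≤ M) :
    ∃ C : ℝ, 0 < C ∧ ∀ R : ℝ, 1 < R →
      ∫ x in ball (0 : Euc n) R, f (u x) ≤ C * R ^ ((n : ℝ) - pm) := by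
  obtain ⟨huC, huint, hweak⟩ := hu
  obtain ⟨c, hc0, hcut⟩ := exists_scaled_cutoff (Euc n)
  obtain ⟨N, hN⟩ := exists_nat_ge pP
  have hM : 0 ≤ M := (abs_nonneg _).trans (hbdd 0)
  have ham := h𝒜.am_pos
  have hbP := h𝒜.bP_pos
  have hgcont : Continuous fun x => f (u x) := hfc.comp huC.continuous
  set K : ℝ := (2 * M + 1) * (N + 1) * bP with hKdef
  have hK : 0 ≤ K := by positivity
  set D : ℝ := am * max 1 (K * c / am) ^ pP with hD
  have hD0 : 0 < D := mul_pos ham (Real.rpow_pos_of_pos (by positivity) _)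
  have hvol : 0 < volume.real (ball (0 : Euc n) 1) :=
    ENNReal.toReal_pos (measure_ball_pos _ _ one_pos).ne' measure_ball_lt_top.ne
  refine ⟨2 ^ n * volume.real (ball (0 : Euc n) 1) * D, by positivity, fun R hR => ?_⟩
  have hR0 : 0 < R := by linarith
  obtain ⟨χ, hχ, hχ0, hχ1, hχR, hχs, hχd⟩ := hcut R hR0
  have hχc : HasCompactSupport χ := (isCompact_closedBall _ _).of_isClosed_subset
    (isClosed_tsupport χ) hχs
  set φ : Euc n → ℝ := fun y => χ y ^ (N + 1) * (u y + M + 1) with hφ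
  have hone : ∀ x, 1 ≤ u x + M + 1 := fun x => by linarith [(abs_le.1 (hbdd x)).1]
  have hφC : ContDiff ℝ 1 φ :=
    ((hχ.of_le (by simp)).pow _).mul ((huC.add contDiff_const).add contDiff_const)
  have hφc : HasCompactSupport φ := by
    refine hχc.mono fun x hx => ?_
    contrapose! hx
    simp [hφ, Function.notMem_support.1 hx]
  have hφ0 : ∀ x, 0 ≤ φ x := fun x =>
    mul_nonneg (pow_nonneg (hχ0 x) _) (by linarith [hone x])
  have htest := weak_inequality_of_contDiff_one hgcont.locallyIntegrable
    (h𝒜.locallyIntegrable_flux hp huC huint)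
    (fun ψ h1 h2 h3 => by simpa only [inner_gradient_eq_fderiv] using hweak ψ h1 h2 h3)
    hφC hφc hφ0
  have hlower : ∫ x in ball (0 : Euc n) R, f (u x) ≤ ∫ x, f (u x) * φ x := by
    have hfφ : Integrable fun x => f (u x) * φ x :=
      (hgcont.mul hφC.continuous).integrable_of_hasCompactSupport hφc.mul_left
    refine (setIntegral_mono_on ?_ hfφ.integrableOn measurableSet_ball fun x hx => ?_).trans
      (setIntegral_le_integral hfφ (.of_forall fun x => mul_nonneg (hf0 _) (hφ0 x)))
    · exact (hgcont.locallyIntegrable.integrableOn_isCompact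
        (isCompact_closedBall 0 R)).mono_set ball_subset_closedBall
    · refine le_mul_of_one_le_right (hf0 _) ?_
      simp only [hφ, hχR x (ball_subset_closedBall hx), one_pow, one_mul]
      exact hone x
  have hpoint : ∀ᵐ x, -fderiv ℝ φ x (𝒜 x (u x) (gradient u x)) ≤
      (closedBall (0 : Euc n) (2 * R)).indicator (fun _ => D * R ^ (-pm)) x := by
    filter_upwards [hp.ae_lb, hp.ae_ub] with x hx1 hx2
    have hpx : 1 < p x := hp.one_lt.trans_le hx1
    have h := h𝒜.neg_fderiv_test_le huC hbdd hχ hχ0 hχ1 (N := N) hpx (by linarith)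
    refine h.trans ?_
    rw [← hKdef]
    by_cases hx : x ∈ closedBall (0 : Euc n) (2 * R)
    · rw [Set.indicator_of_mem hx, hD, mul_assoc am]
      refine mul_le_mul_of_nonneg_left (rpow_div_le_max_rpow_mul (by positivity) ?_ hR
        (by linarith [hp.one_lt]) hx1 hx2) ham.le
      calc K * ‖fderiv ℝ χ x‖ / am ≤ K * (c / R) / am := by gcongr; exact hχd x
        _ = K * c / am / R := by ring
    · have hz : fderiv ℝ χ x = 0 := fderiv_of_notMem_tsupport ℝ fun h => hx (hχs h)
      rw [Set.indicator_of_notMem hx, hz]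
      simp [Real.zero_rpow (show p x ≠ 0 by linarith)]
  have hupper : -∫ x, fderiv ℝ φ x (𝒜 x (u x) (gradient u x)) ≤
      ∫ x, (closedBall (0 : Euc n) (2 * R)).indicator (fun _ => D * R ^ (-pm)) x := by
    rw [← integral_neg]
    have hint : Integrable
        ((closedBall (0 : Euc n) (2 * R)).indicator fun _ => D * R ^ (-pm)) := by
      rw [integrable_indicator_iff measurableSet_closedBall]
      exact integrableOn_const measure_closedBall_lt_top.ne
    by_cases hi : Integrable fun x => -fderiv ℝ φ x (𝒜 x (u x) (gradient u x))
    · exact integral_mono_ae hi hint hpoint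
    · rw [integral_undef hi]
      exact integral_nonneg (Set.indicator_nonneg fun _ _ => by positivity)
  refine (hlower.trans (htest.trans hupper)).trans_eq ?_
  rw [integral_indicator measurableSet_closedBall, setIntegral_const,
    Measure.addHaar_real_closedBall _ _ (by positivity), finrank_euclideanSpace_fin, smul_eq_mul,
    sub_eq_add_neg, Real.rpow_add hR0, Real.rpow_natCast, mul_pow]
  ring

end Caccioppoli

/-- The estimate inside the proof of Theorem 4.7: let `p⁻ > n`, let `f` be continuous
and nonnegative and let `u` be a supersolution of `div 𝒜(x,u,∇u) = f(u)` with
`|u| ≤ M`. Then there is `C = C(n, p⁺, a₋, b⁺, M)` with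
`∫_{B_R} f(u) ≤ C R^{n−p⁻}` for all `R > 1`; consequently `∫_{ℝⁿ} f(u) = 0` and
`f(u(x)) = 0` for every `x`. -/
theorem supersolution_f_vanishes {n : ℕ} (p : Euc n → ℝ) (pm pP : ℝ)
    (hp : IsVarExp p pm pP) (hpn : (n : ℝ) < pm)
    (𝒜 : Euc n → ℝ → Euc n → Euc n) (am bP : ℝ)
    (h𝒜 : IsNSGrowth p 𝒜 am bP)
    (f : ℝ → ℝ) (hfc : Continuous f) (hf0 : ∀ t, 0 ≤ f t)
    (u : Euc n → ℝ) (hu : IsFSupersolution p 𝒜 f u)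
    (M : ℝ) (hbdd : ∀ x, |u x| ≤ M) :
    (∃ C : ℝ, 0 < C ∧ ∀ R : ℝ, 1 < R →
      ∫ x in Metric.ball (0 : Euc n) R, f (u x) ≤ C * R ^ ((n : ℝ) - pm)) ∧
    (∫ x : Euc n, f (u x)) = 0 ∧ (∀ x : Euc n, f (u x) = 0) := by
  have hbound := exists_setIntegral_ball_le hp h𝒜 hfc hf0 hu hbdd
  have hgcont : Continuous fun x => f (u x) := hfc.comp hu.1.continuous
  have hzero : ∀ x, f (u x) = 0 := by
    obtain ⟨C, -, hC⟩ := hbound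
    have hlim : Filter.Tendsto (fun R : ℝ => C * R ^ ((n : ℝ) - pm)) Filter.atTop (nhds 0) := by
      simpa using (tendsto_rpow_neg_atTop (sub_pos.2 hpn)).const_mul C
    have hloc : ∀ r, IntegrableOn (fun x => f (u x)) (ball (0 : Euc n) r) := fun r =>
      (hgcont.locallyIntegrable.integrableOn_isCompact
        (isCompact_closedBall 0 r)).mono_set ball_subset_closedBall
    intro x
    have hle : ∫ y in ball (0 : Euc n) (‖x‖ + 1), f (u y) ≤ 0 := by
      refine ge_of_tendsto hlim ?_
      filter_upwards [Filter.eventually_gt_atTop 1, Filter.eventually_ge_atTop (‖x‖ + 1)]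
        with R hR1 hRx
      exact (setIntegral_mono_set (hloc R) (.of_forall fun y => hf0 _)
        (ball_subset_ball hRx).eventuallyLE).trans (hC R hR1)
    have heq := le_antisymm hle (integral_nonneg fun y => hf0 _)
    rw [setIntegral_eq_zero_iff_of_nonneg_ae (.of_forall fun y => hf0 _) (hloc _)] at heq
    exact Measure.eqOn_open_of_ae_eq heq isOpen_ball hgcont.continuousOn continuousOn_const
      (mem_ball_zero_iff.2 (lt_add_one _))
  exact ⟨hbound, by simp [hzero], hzero⟩

end
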